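/- Let α, β, γ, μ be complex numbers and ε a real number with Re γ > Re α > 0, Re β > 0, 0 < ε < min(Re α, Re β) and 0 < Im μ < 2π. Then B(α,β,γ;μ,ε) = (Γ(β)/Γ(γ−α)) · ∫_{0}^{1} u^{α−1} (1−u)^{γ−α−1} (1−u·e^{μ})^{−β} du, where the integral on the right converges absolutely. (For u ∈ [0,1] the quantity 1−u·e^{μ} never lies in (−∞,0], so the principal power is well defined.) -/

import Mathlib

open Complex MeasureTheory Real

/-- The Barnes integral `B(α,β,γ;μ,ε)`:
`(1/(2π)) ∫_{−∞}^{∞} e^{(−ε+iy)(μ−πi)} Γ(ε−iy) Γ(α−ε+iy) Γ(β−ε+iy) / Γ(γ−ε+iy) dy`. -/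
noncomputable def BarnesB (α β γ μ : ℂ) (ε : ℝ) : ℂ :=
  (1 / (2 * (π : ℂ))) * ∫ y : ℝ,
    Complex.exp ((-(ε : ℂ) + Complex.I * (y : ℂ)) * (μ - (π : ℂ) * Complex.I)) *
      Complex.Gamma ((ε : ℂ) - Complex.I * (y : ℂ)) *
      Complex.Gamma (α - (ε : ℂ) + Complex.I * (y : ℂ)) *
      Complex.Gamma (β - (ε : ℂ) + Complex.I * (y : ℂ)) /
      Complex.Gamma (γ - (ε : ℂ) + Complex.I * (y : ℂ))

open Set
open scoped Topology

theorem re_exp_pos_of_abs_im_lt {w : ℂ} (hw : |w.im| < π / 2) : 0 < (Complex.exp w).re := by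
  rw [Complex.exp_re]
  exact mul_pos (Real.exp_pos _) (Real.cos_pos_of_mem_Ioo (abs_lt.mp hw))

theorem integrableOn_rpow_mul_exp_neg_mul {σ c : ℝ} (hσ : 0 < σ) (hc : 0 < c) :
    IntegrableOn (fun t : ℝ => t ^ (σ - 1) * Real.exp (-(c * t))) (Ioi 0) := by
  simpa using integrableOn_rpow_mul_exp_neg_mul_rpow (p := 1) (s := σ - 1) (by linarith)
    one_pos hc

theorem norm_cpow_mul_exp_neg {s a : ℂ} {t : ℝ} (ht : 0 < t) :
    ‖(t : ℂ) ^ (s - 1) * Complex.exp (-(a * t))‖ =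
      t ^ (s.re - 1) * Real.exp (-(a.re * t)) := by
  rw [norm_mul, Complex.norm_cpow_eq_rpow_re_of_pos ht, Complex.norm_exp]
  simp

theorem integrableOn_cpow_mul_exp_neg_mul {s a : ℂ} (hs : 0 < s.re) (ha : 0 < a.re) :
    IntegrableOn (fun t : ℝ => (t : ℂ) ^ (s - 1) * Complex.exp (-(a * t))) (Ioi 0) := by
  refine (integrableOn_rpow_mul_exp_neg_mul hs ha).mono' ?_ ?_
  · refine ContinuousOn.aestronglyMeasurable (fun t ht => ?_) measurableSet_Ioi
    have : (t : ℂ) ∈ Complex.slitPlane := Or.inl (by simpa using ht)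
    exact ContinuousAt.continuousWithinAt (by fun_prop (disch := assumption))
  · filter_upwards [ae_restrict_mem measurableSet_Ioi] with t ht
    exact (norm_cpow_mul_exp_neg ht).le

theorem differentiableAt_integral_cpow_mul_exp_neg_mul {s a : ℂ} (hs : 0 < s.re)
    (ha : 0 < a.re) :
    DifferentiableAt ℂ
      (fun a : ℂ => ∫ t : ℝ in Ioi 0, (t : ℂ) ^ (s - 1) * Complex.exp (-(a * t))) a := by
  have hball : ∀ b ∈ Metric.ball a (a.re / 2), a.re / 2 < b.re := by
    intro b hb
    have h1 := (Complex.abs_re_le_norm (b - a)).trans_lt (by simpa [dist_eq_norm] using hb)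
    rw [Complex.sub_re, abs_lt] at h1
    linarith [h1.1]
  refine (hasDerivAt_integral_of_dominated_loc_of_deriv_le (μ := volume.restrict (Ioi 0))
    (F := fun b (t : ℝ) => (t : ℂ) ^ (s - 1) * Complex.exp (-(b * t)))
    (F' := fun b (t : ℝ) => -((t : ℂ) ^ (s + 1 - 1) * Complex.exp (-(b * t))))
    (bound := fun t => t ^ (s.re + 1 - 1) * Real.exp (-(a.re / 2 * t)))
    (Metric.ball_mem_nhds a (half_pos ha)) ?_ (integrableOn_cpow_mul_exp_neg_mul hs ha)
    (integrableOn_cpow_mul_exp_neg_mul (s := s + 1) (by simp; linarith) ha).neg.aestronglyMeasurable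
    ?_ (integrableOn_rpow_mul_exp_neg_mul (by linarith) (half_pos ha)) ?_).2.differentiableAt
  · filter_upwards [Metric.ball_mem_nhds a (half_pos ha)] with b hb
    exact (integrableOn_cpow_mul_exp_neg_mul hs
      ((half_pos ha).trans (hball b hb))).aestronglyMeasurable
  · filter_upwards [ae_restrict_mem measurableSet_Ioi] with t ht b hb
    rw [norm_neg, norm_cpow_mul_exp_neg ht, Complex.add_re, Complex.one_re]
    have ht' : 0 < t := ht
    have := (hball b hb).le
    gcongr
  · filter_upwards [ae_restrict_mem measurableSet_Ioi] with t ht b hb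
    have ht0 : (t : ℂ) ≠ 0 := by simpa using (mem_Ioi.mp ht).ne'
    have h := (((hasDerivAt_id b).mul_const (t : ℂ)).neg.cexp).const_mul ((t : ℂ) ^ (s - 1))
    refine h.congr_deriv ?_
    rw [show s + 1 - 1 = s - 1 + 1 by ring, Complex.cpow_add _ _ ht0, Complex.cpow_one]
    simp
    ring

theorem integral_cpow_mul_exp_neg_mul_Ioi_of_re_pos {s a : ℂ} (hs : 0 < s.re) (ha : 0 < a.re) :
    ∫ t : ℝ in Ioi 0, (t : ℂ) ^ (s - 1) * Complex.exp (-(a * t)) =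
      (1 / a) ^ s * Complex.Gamma s := by
  set U : Set ℂ := {a : ℂ | 0 < a.re} with hU
  have hUo : IsOpen U := isOpen_lt continuous_const Complex.continuous_re
  have hF : AnalyticOnNhd ℂ
      (fun a : ℂ => ∫ t : ℝ in Ioi 0, (t : ℂ) ^ (s - 1) * Complex.exp (-(a * t))) U :=
    DifferentiableOn.analyticOnNhd (fun a ha =>
      (differentiableAt_integral_cpow_mul_exp_neg_mul hs ha).differentiableWithinAt) hUo
  have hG : AnalyticOnNhd ℂ (fun a : ℂ => (1 / a) ^ s * Complex.Gamma s) U := by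
    refine DifferentiableOn.analyticOnNhd (fun a ha => ?_) hUo
    have ha0 : a ≠ 0 := fun h => by simp [hU, h] at ha
    have hslit : 1 / a ∈ Complex.slitPlane := by
      refine Or.inl ?_
      rw [one_div, Complex.inv_re]
      exact div_pos ha (Complex.normSq_pos.mpr ha0)
    refine DifferentiableAt.differentiableWithinAt ?_
    exact ((((differentiableAt_const 1).div differentiableAt_id ha0).cpow
      (differentiableAt_const s) hslit).mul_const _)
  refine hF.eqOn_of_preconnected_of_frequently_eq hG
    (convex_halfSpace_re_gt 0).isPreconnected (z₀ := 1) (by simp [hU]) ?_ ha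
  have hlim : Filter.Tendsto (fun x : ℝ => (x : ℂ)) (𝓝[>] 1) (𝓝[≠] 1) := by
    refine tendsto_nhdsWithin_iff.mpr ⟨?_, ?_⟩
    · exact (Complex.continuous_ofReal.tendsto' 1 1 (by simp)).mono_left nhdsWithin_le_nhds
    · filter_upwards [self_mem_nhdsWithin] with x hx
      simpa using (mem_Ioi.mp hx).ne'
  refine hlim.frequently (Filter.Eventually.frequently ?_)
  filter_upwards [self_mem_nhdsWithin] with x hx
  exact Complex.integral_cpow_mul_exp_neg_mul_Ioi hs (one_pos.trans hx)

theorem integral_cpow_mul_exp_neg_exp_mul {s w : ℂ} (hs : 0 < s.re) (hw : |w.im| < π / 2) :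
    ∫ t : ℝ in Ioi 0, (t : ℂ) ^ (s - 1) * Complex.exp (-(Complex.exp w * t)) =
      Complex.exp (-(w * s)) * Complex.Gamma s := by
  rw [integral_cpow_mul_exp_neg_mul_Ioi_of_re_pos hs (re_exp_pos_of_abs_im_lt hw), one_div,
    ← Complex.exp_neg, Complex.cpow_def_of_ne_zero (Complex.exp_ne_zero _), Complex.log_exp]
  · ring_nf
  all_goals
    rw [abs_lt] at hw
    simp only [Complex.neg_im]
    linarith [Real.pi_pos]

/-- Exponential decay of the Gamma function along vertical lines. -/
theorem norm_Gamma_le {s : ℂ} {θ : ℝ} (hs : 0 < s.re) (hθ : |θ| < π / 2) :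
    ‖Complex.Gamma s‖ ≤
      (1 / Real.cos θ) ^ s.re * Real.Gamma s.re * Real.exp (θ * s.im) := by
  have hw : |(-(θ * I)).im| < π / 2 := by simpa using hθ
  have hcos : 0 < Real.cos θ := Real.cos_pos_of_mem_Ioo (abs_lt.mp hθ)
  have hre : (Complex.exp (-(θ * I))).re = Real.cos θ := by simp [Complex.exp_re]
  have h := norm_integral_le_integral_norm (μ := volume.restrict (Ioi 0))
    (fun t : ℝ => (t : ℂ) ^ (s - 1) * Complex.exp (-(Complex.exp (-(θ * I)) * t)))
  rw [integral_cpow_mul_exp_neg_exp_mul hs hw,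
    setIntegral_congr_fun measurableSet_Ioi (fun t ht => norm_cpow_mul_exp_neg ht), hre,
    Real.integral_rpow_mul_exp_neg_mul_Ioi hs hcos, norm_mul, Complex.norm_exp] at h
  have h2 : (-(-(θ * I) * s)).re = -(θ * s.im) := by simp
  rw [h2, Real.exp_neg, inv_mul_le_iff₀ (Real.exp_pos _)] at h
  linarith

theorem integrable_exp_neg_mul_abs {δ : ℝ} (hδ : 0 < δ) :
    Integrable (fun y : ℝ => Real.exp (-δ * |y|)) := by
  rw [← integrableOn_univ, ← Iic_union_Ioi (a := (0 : ℝ)), integrableOn_union]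
  constructor
  · refine (integrableOn_exp_mul_Iic hδ 0).congr_fun (fun y hy => ?_) measurableSet_Iic
    simp only [abs_of_nonpos (mem_Iic.mp hy)]
    ring_nf
  · refine (exp_neg_integrableOn_Ioi 0 hδ).congr_fun (fun y hy => ?_) measurableSet_Ioi
    simp only [abs_of_pos (mem_Ioi.mp hy)]

theorem continuous_Gamma_vertical {σ : ℂ} (c : ℂ) (hσ : 0 < σ.re) (hc : c.re = 0) :
    Continuous (fun y : ℝ => Complex.Gamma (σ + c * y)) := by
  refine continuous_iff_continuousAt.mpr fun y => ?_
  refine ContinuousAt.comp (f := fun y : ℝ => σ + c * y) ?_ (by fun_prop)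
  refine (Complex.differentiableAt_Gamma _ fun m hm => ?_).continuousAt
  have := congrArg Complex.re hm
  simp [hc] at this
  linarith [(Nat.cast_nonneg m : (0 : ℝ) ≤ m)]

theorem integrable_Gamma_mul_exp {ε : ℝ} {w : ℂ} (hε : 0 < ε) (hw : |w.im| < π / 2) :
    Integrable (fun y : ℝ => Complex.Gamma (ε - I * y) *
      Complex.exp ((-(ε : ℂ) + I * y) * w)) := by
  obtain ⟨θ, hθ1, hθ2⟩ := exists_between hw
  have hθ0 : 0 < θ := (abs_nonneg _).trans_lt hθ1
  have hcos : 0 < Real.cos θ := Real.cos_pos_of_mem_Ioo ⟨by linarith, hθ2⟩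
  have hdom := (integrable_exp_neg_mul_abs (sub_pos.mpr hθ1)).const_mul
    ((1 / Real.cos θ) ^ ε * Real.Gamma ε * Real.exp (-(ε * w.re)))
  refine hdom.mono' (Continuous.aestronglyMeasurable ?_) (.of_forall fun y => ?_)
  · have := continuous_Gamma_vertical (σ := ε) (-I) (by simpa) (by simp)
    simp only [neg_mul, ← sub_eq_add_neg] at this
    fun_prop
  · have key : ‖Complex.Gamma (ε - I * y)‖ ≤
        (1 / Real.cos θ) ^ ε * Real.Gamma ε * Real.exp (-(θ * |y|)) := by
      rcases le_total 0 y with hy | hy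
      · have := norm_Gamma_le (s := ε - I * y) (θ := θ) (by simpa) (by rwa [abs_of_pos hθ0])
        simpa [abs_of_nonneg hy] using this
      · have := norm_Gamma_le (s := ε - I * y) (θ := -θ) (by simpa)
          (by rwa [abs_neg, abs_of_pos hθ0])
        simpa [abs_of_nonpos hy] using this
    have hexp : ‖Complex.exp ((-(ε : ℂ) + I * y) * w)‖ ≤
        Real.exp (-(ε * w.re)) * Real.exp (|w.im| * |y|) := by
      rw [Complex.norm_exp, ← Real.exp_add, Real.exp_le_exp, ← abs_mul]
      have := neg_le_abs (w.im * y)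
      simp only [Complex.add_re, Complex.neg_re, Complex.mul_re, Complex.add_im, Complex.neg_im,
        Complex.mul_im, ofReal_re, ofReal_im, I_re, I_im]
      linarith [mul_comm y w.im]
    rw [norm_mul]
    refine (mul_le_mul key hexp (norm_nonneg _) (by positivity)).trans_eq ?_
    rw [show -(θ - |w.im|) * |y| = -(θ * |y|) + |w.im| * |y| by ring, Real.exp_add]
    ring

/-- The Cahen–Mellin integral. -/
theorem integral_Gamma_mul_exp {ε : ℝ} {w : ℂ} (hε : 0 < ε) (hw : |w.im| < π / 2) :
    ∫ y : ℝ, Complex.Gamma (ε - I * y) * Complex.exp ((-(ε : ℂ) + I * y) * w) =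
      2 * π * Complex.exp (-Complex.exp w) := by
  set f : ℝ → ℂ := fun t => Complex.exp (-(Complex.exp w * t)) with hf
  have hm : ∀ y : ℝ, mellin f (ε + y * I) = Complex.Gamma (ε - I * (-y : ℝ)) *
      Complex.exp ((-(ε : ℂ) + I * (-y : ℝ)) * w) := by
    intro y
    simp only [mellin, smul_eq_mul, hf]
    rw [integral_cpow_mul_exp_neg_exp_mul (by simpa) hw, mul_comm]
    push_cast
    ring_nf
  have hinv := mellinInv_mellin_eq ε f one_pos
    (by simpa [MellinConvergent, hf] using
      integrableOn_cpow_mul_exp_neg_mul (s := ε) (by simpa) (re_exp_pos_of_abs_im_lt hw))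
    (by
      simp only [VerticalIntegrable, hm]
      exact (integrable_Gamma_mul_exp hε hw).comp_neg)
    (by fun_prop)
  simp only [mellinInv, hm, ofReal_one, one_cpow, one_smul] at hinv
  rw [integral_neg_eq_self (fun y : ℝ => Complex.Gamma (ε - I * y) *
    Complex.exp ((-(ε : ℂ) + I * y) * w))] at hinv
  simp only [hf, ofReal_one, mul_one, real_smul] at hinv
  rw [← hinv]
  push_cast
  rw [← mul_assoc, mul_one_div_cancel (by simp [Real.pi_ne_zero]), one_mul]

/-- Fubini for a kernel of the form `exp (i y log t)`. -/
theorem integral_mul_integral_exp_log_swap {ν : Measure ℝ} [SFinite ν] {g h : ℝ → ℂ}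
    (hg : Integrable g) (hh : Integrable h ν) :
    ∫ y : ℝ, g y * ∫ t, h t * Complex.exp (I * y * Real.log t) ∂ν =
      ∫ t, (h t * ∫ y : ℝ, g y * Complex.exp (I * y * Real.log t)) ∂ν := by
  have hint : Integrable (Function.uncurry fun y t : ℝ =>
      g y * h t * Complex.exp (I * y * Real.log t)) (volume.prod ν) := by
    refine (hg.mul_prod hh).mul_bdd (c := 1) ?_ (.of_forall fun p => ?_)
    · exact Measurable.aestronglyMeasurable (by fun_prop)
    · rw [Complex.norm_exp]
      simp
  have hswap := integral_integral_swap hint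
  simp only [← integral_const_mul]
  have hcomm : ∀ y t : ℝ, h t * (g y * Complex.exp (I * y * Real.log t)) =
      g y * h t * Complex.exp (I * y * Real.log t) := fun y t => by ring
  simp only [hcomm, ← mul_assoc] at hswap ⊢
  exact hswap

theorem exp_mul_one_add_exp_cpow {w β : ℂ} (hw : |w.im| < π) :
    Complex.exp (-(w / 2) * β) * (Complex.exp (w / 2) + Complex.exp (-(w / 2))) ^ (-β) =
      (1 + Complex.exp w) ^ (-β) := by
  have hw2 := abs_lt.mp hw
  have hhalf : (w / 2).im = w.im / 2 := by simp
  have h1 : |(w / 2).im| < π / 2 := by rw [hhalf, abs_lt]; constructor <;> linarith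
  have h2 : |(-(w / 2)).im| < π / 2 := by rwa [Complex.neg_im, abs_neg]
  set z := Complex.exp (w / 2) + Complex.exp (-(w / 2)) with hz
  have hzre : 0 < z.re := add_pos (re_exp_pos_of_abs_im_lt h1) (re_exp_pos_of_abs_im_lt h2)
  have hz0 : z ≠ 0 := fun h => by simp [h] at hzre
  have hprod : 1 + Complex.exp w = Complex.exp (w / 2) * z := by
    rw [hz, mul_add, ← Complex.exp_add, ← Complex.exp_add]
    simp [add_comm]
  have harg := abs_lt.mp (Complex.abs_arg_lt_pi_div_two_iff.mpr (Or.inl hzre))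
  have hloge : Complex.log (Complex.exp (w / 2)) = w / 2 :=
    Complex.log_exp (by rw [hhalf]; linarith) (by rw [hhalf]; linarith)
  have harge : (Complex.exp (w / 2)).arg = w.im / 2 := by
    rw [← Complex.log_im, hloge, hhalf]
  rw [hprod, Complex.cpow_def_of_ne_zero hz0,
    Complex.cpow_def_of_ne_zero (mul_ne_zero (Complex.exp_ne_zero _) hz0),
    Complex.log_mul (Complex.exp_ne_zero _) hz0, hloge, ← Complex.exp_add]
  · ring_nf
  · rw [harge]
    constructor <;> linarith

theorem cpow_mul_exp_log {t y : ℝ} {s : ℂ} (ht : 0 < t) :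
    (t : ℂ) ^ s * Complex.exp (I * y * Real.log t) = (t : ℂ) ^ (s + I * y) := by
  have ht0 : (t : ℂ) ≠ 0 := by simpa using ht.ne'
  rw [Complex.cpow_add _ _ ht0, Complex.cpow_def_of_ne_zero ht0 (I * y), Complex.ofReal_log ht.le]
  ring_nf

theorem exp_ofReal_log {t : ℝ} (ht : 0 < t) : Complex.exp (Real.log t) = t := by
  rw [← Complex.ofReal_exp, Real.exp_log ht]

theorem cpow_sub_mul_exp_log {t ε : ℝ} {s : ℂ} (ht : 0 < t) :
    (t : ℂ) ^ (s - ε - 1) * Complex.exp (ε * Real.log t) = (t : ℂ) ^ (s - 1) := by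
  have ht0 : (t : ℂ) ≠ 0 := by simpa using ht.ne'
  rw [show s - 1 = s - ε - 1 + ε by ring, Complex.cpow_add _ _ ht0,
    Complex.cpow_def_of_ne_zero ht0 ε, Complex.ofReal_log ht.le, mul_comm (ε : ℂ)]

theorem exp_mul_exp_log (ε y l w : ℂ) :
    Complex.exp ((-ε + I * y) * w) * Complex.exp (I * y * l) =
      Complex.exp (ε * l) * Complex.exp ((-ε + I * y) * (w + l)) := by
  rw [← Complex.exp_add, ← Complex.exp_add]
  ring_nf

theorem abs_im_half_lt {w : ℂ} (hw : |w.im| < π) : |(w / 2).im| < π / 2 := by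
  have : (w / 2).im = w.im / 2 := by simp
  rw [this, abs_div, abs_two]
  linarith

theorem integrable_Gamma_mul_Gamma_mul_exp {ε : ℝ} {β w : ℂ} (hε : 0 < ε) (hβ : ε < β.re)
    (hw : |w.im| < π) :
    Integrable (fun y : ℝ => Complex.Gamma (ε - I * y) * Complex.exp ((-(ε : ℂ) + I * y) * w) *
      Complex.Gamma (β - ε + I * y)) := by
  have hw2 := abs_im_half_lt hw
  have hβ' : 0 < (β - ε).re := by simpa using hβ
  have hbdd : ∀ y : ℝ, ‖Complex.exp (I * y * (w / 2)) * Complex.Gamma (β - ε + I * y)‖ ≤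
      (1 / Real.cos (w / 2).im) ^ (β - ε).re * Real.Gamma (β - ε).re *
        Real.exp ((w / 2).im * β.im) := by
    intro y
    have h := norm_Gamma_le (s := β - ε + I * y) (by simpa using hβ) hw2
    have hre : (β - ε + I * y).re = (β - ε).re := by simp
    have him : (β - ε + I * y).im = β.im + y := by simp
    have hexp : (I * y * (w / 2)).re = -((w / 2).im * y) := by simp; ring
    rw [norm_mul, Complex.norm_exp, hexp, Real.exp_neg, inv_mul_le_iff₀ (Real.exp_pos _)]
    rw [hre, him, mul_add, Real.exp_add] at h
    linarith
  have hcont := continuous_Gamma_vertical (σ := β - ε) I hβ' (by simp)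
  have hint := (integrable_Gamma_mul_exp hε hw2).mul_bdd
    (g := fun y : ℝ => Complex.exp (I * y * (w / 2)) * Complex.Gamma (β - ε + I * y))
    (Continuous.aestronglyMeasurable (by fun_prop)) (.of_forall hbdd)
  refine (hint.const_mul (Complex.exp (-(ε : ℂ) * (w / 2)))).congr (.of_forall fun y => ?_)
  have : (-(ε : ℂ) + I * y) * w =
      -(ε : ℂ) * (w / 2) + (-(ε : ℂ) + I * y) * (w / 2) + I * y * (w / 2) := by ring
  simp only [this, Complex.exp_add]
  ring

/-- Barnes' integral representation of the binomial function. -/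
theorem integral_Gamma_mul_Gamma_mul_exp {ε : ℝ} {β w : ℂ} (hε : 0 < ε) (hβ : ε < β.re)
    (hw : |w.im| < π) :
    ∫ y : ℝ, Complex.Gamma (ε - I * y) * Complex.exp ((-(ε : ℂ) + I * y) * w) *
      Complex.Gamma (β - ε + I * y) =
      2 * π * (Complex.Gamma β * (1 + Complex.exp w) ^ (-β)) := by
  have hw2 := abs_im_half_lt hw
  have hw2' : |(-(w / 2)).im| < π / 2 := by rwa [Complex.neg_im, abs_neg]
  have hβ' : 0 < (β - ε).re := by simpa using hβ
  have hβ0 : 0 < β.re := hε.trans hβ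
  have ha := re_exp_pos_of_abs_im_lt hw2
  have hb := re_exp_pos_of_abs_im_lt hw2'
  have hab : 0 < (Complex.exp (w / 2) + Complex.exp (-(w / 2))).re := add_pos ha hb
  have hswap := integral_mul_integral_exp_log_swap (ν := volume.restrict (Ioi 0))
    (integrable_Gamma_mul_exp hε hw2)
    (integrableOn_cpow_mul_exp_neg_mul hβ' hb)
  have hleft : ∀ y : ℝ,
      Complex.Gamma (ε - I * y) * Complex.exp ((-(ε : ℂ) + I * y) * (w / 2)) *
        ∫ t : ℝ in Ioi 0, (t : ℂ) ^ (β - ε - 1) * Complex.exp (-(Complex.exp (-(w / 2)) * t)) *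
          Complex.exp (I * y * Real.log t) =
      Complex.exp ((w / 2) * β) * (Complex.Gamma (ε - I * y) *
        Complex.exp ((-(ε : ℂ) + I * y) * w) * Complex.Gamma (β - ε + I * y)) := by
    intro y
    have hinner : ∫ t : ℝ in Ioi 0, (t : ℂ) ^ (β - ε - 1) *
          Complex.exp (-(Complex.exp (-(w / 2)) * t)) * Complex.exp (I * y * Real.log t) =
        Complex.exp (-(-(w / 2) * (β - ε + I * y))) * Complex.Gamma (β - ε + I * y) := by
      rw [← integral_cpow_mul_exp_neg_exp_mul (by simpa using hβ) hw2']
      refine setIntegral_congr_fun measurableSet_Ioi fun t ht => ?_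
      have := cpow_mul_exp_log (y := y) (s := β - ε - 1) ht
      simp only [show β - ε + I * y - 1 = β - ε - 1 + I * y by ring, ← this]
      ring
    have hexp : Complex.exp ((-(ε : ℂ) + I * y) * (w / 2)) *
        Complex.exp (-(-(w / 2) * (β - ε + I * y))) =
        Complex.exp ((w / 2) * β) * Complex.exp ((-(ε : ℂ) + I * y) * w) := by
      rw [← Complex.exp_add, ← Complex.exp_add]
      ring_nf
    rw [hinner]
    linear_combination Complex.Gamma (ε - I * y) * Complex.Gamma (β - ε + I * y) * hexp
  have hright : ∫ t : ℝ in Ioi 0, (t : ℂ) ^ (β - ε - 1) *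
        Complex.exp (-(Complex.exp (-(w / 2)) * t)) *
        ∫ y : ℝ, Complex.Gamma (ε - I * y) * Complex.exp ((-(ε : ℂ) + I * y) * (w / 2)) *
          Complex.exp (I * y * Real.log t) =
      2 * π * ∫ t : ℝ in Ioi 0, (t : ℂ) ^ (β - 1) *
        Complex.exp (-((Complex.exp (w / 2) + Complex.exp (-(w / 2))) * t)) := by
    rw [← integral_const_mul]
    refine setIntegral_congr_fun measurableSet_Ioi fun t ht => ?_
    have hC := integral_Gamma_mul_exp (w := w / 2 + Real.log t) hε (by
      rwa [Complex.add_im, Complex.ofReal_im, add_zero])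
    rw [Complex.exp_add, exp_ofReal_log ht] at hC
    have hinner : ∫ y : ℝ, Complex.Gamma (ε - I * y) *
          Complex.exp ((-(ε : ℂ) + I * y) * (w / 2)) * Complex.exp (I * y * Real.log t) =
        Complex.exp (ε * Real.log t) * (2 * π * Complex.exp (-(Complex.exp (w / 2) * t))) := by
      rw [← hC, ← integral_const_mul]
      congr 1 with y
      linear_combination Complex.Gamma (ε - I * y) * exp_mul_exp_log ε y (Real.log t) (w / 2)
    have hsplit : Complex.exp (-((Complex.exp (w / 2) + Complex.exp (-(w / 2))) * t)) =
        Complex.exp (-(Complex.exp (w / 2) * t)) * Complex.exp (-(Complex.exp (-(w / 2)) * t)) := by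
      rw [← Complex.exp_add]
      ring_nf
    simp only [hinner, hsplit, ← cpow_sub_mul_exp_log (ε := ε) (s := β) ht]
    ring
  simp only [hleft] at hswap
  rw [integral_const_mul, hright, integral_cpow_mul_exp_neg_mul_Ioi_of_re_pos hβ0 hab] at hswap
  have hz : (1 / (Complex.exp (w / 2) + Complex.exp (-(w / 2)))) ^ β =
      (Complex.exp (w / 2) + Complex.exp (-(w / 2))) ^ (-β) := by
    rw [one_div, Complex.inv_cpow, Complex.cpow_neg]
    have := abs_lt.mp (Complex.abs_arg_lt_pi_div_two_iff.mpr (Or.inl hab))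
    linarith [Real.pi_pos]
  rw [← exp_mul_one_add_exp_cpow hw, ← hz]
  have hE : Complex.exp (-(w / 2) * β) * Complex.exp (w / 2 * β) = 1 := by
    rw [← Complex.exp_add]
    ring_nf
    exact Complex.exp_zero
  linear_combination Complex.exp (-(w / 2) * β) * hswap -
    (∫ y : ℝ, Complex.Gamma (ε - I * y) * Complex.exp ((-(ε : ℂ) + I * y) * w) *
      Complex.Gamma (β - ε + I * y)) * hE

theorem one_sub_mul_exp_mem_slitPlane {u : ℝ} {μ : ℂ} (hu : 0 ≤ u) (hμ0 : 0 < μ.im)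
    (hμ : μ.im < 2 * π) : 1 - (u : ℂ) * Complex.exp μ ∈ Complex.slitPlane := by
  rw [Complex.mem_slitPlane_iff]
  have him : (1 - (u : ℂ) * Complex.exp μ).im = -(u * (Real.exp μ.re * Real.sin μ.im)) := by
    simp [Complex.exp_im]
  have hre : (1 - (u : ℂ) * Complex.exp μ).re = 1 - u * (Real.exp μ.re * Real.cos μ.im) := by
    simp [Complex.exp_re]
  rw [him, hre]
  by_contra! h
  obtain ⟨h1, h2⟩ := h
  have hu0 : u ≠ 0 := by
    rintro rfl
    norm_num at h1
  have hsin : Real.sin (μ.im - π) = 0 := by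
    rw [Real.sin_sub_pi, neg_eq_zero]
    simpa [hu0, Real.exp_ne_zero] using h2
  rw [Real.sin_eq_zero_iff_of_lt_of_lt (by linarith) (by linarith), sub_eq_zero] at hsin
  rw [hsin, Real.cos_pi] at h1
  have : 0 ≤ u * Real.exp μ.re := by positivity
  linarith

theorem integrableOn_beta {a b : ℂ} (ha : 0 < a.re) (hb : 0 < b.re) :
    IntegrableOn (fun u : ℝ => (u : ℂ) ^ (a - 1) * (1 - (u : ℂ)) ^ (b - 1)) (Ioo 0 1) :=
  ((intervalIntegrable_iff_integrableOn_Ioc_of_le zero_le_one).mp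
    (Complex.betaIntegral_convergent ha hb)).mono_set Ioo_subset_Ioc_self

theorem integral_beta {a b : ℂ} (ha : 0 < a.re) (hb : 0 < b.re) :
    ∫ u : ℝ in Ioo 0 1, (u : ℂ) ^ (a - 1) * (1 - (u : ℂ)) ^ (b - 1) =
      Complex.Gamma a * Complex.Gamma b / Complex.Gamma (a + b) := by
  rw [← Complex.betaIntegral_eq_Gamma_mul_div a b ha hb, Complex.betaIntegral,
    intervalIntegral.integral_of_le zero_le_one, integral_Ioc_eq_integral_Ioo]

/-- The Barnes integral equals
`(Γ(β)/Γ(γ−α)) ∫_{0}^{1} u^{α−1} (1−u)^{γ−α−1} (1−u e^μ)^{−β} du`,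
the integral on the right converging absolutely. -/
theorem barnes_integral_eq_euler_integral
    (α β γ μ : ℂ) (ε : ℝ)
    (hγα : α.re < γ.re) (hα : 0 < α.re) (hβ : 0 < β.re)
    (hε0 : 0 < ε) (hε : ε < min α.re β.re)
    (hμim0 : 0 < μ.im) (hμim : μ.im < 2 * π) :
    IntegrableOn (fun u : ℝ =>
      (u : ℂ) ^ (α - 1) * (1 - (u : ℂ)) ^ (γ - α - 1) *
        (1 - (u : ℂ) * Complex.exp μ) ^ (-β)) (Set.Ioo 0 1) ∧
    BarnesB α β γ μ ε =
      Complex.Gamma β / Complex.Gamma (γ - α) *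
        ∫ u : ℝ in Set.Ioo 0 1,
          (u : ℂ) ^ (α - 1) * (1 - (u : ℂ)) ^ (γ - α - 1) *
            (1 - (u : ℂ) * Complex.exp μ) ^ (-β) := by
  have hγα' : 0 < (γ - α).re := by simpa using hγα
  have hεα : 0 < (α - ε).re := by simpa using hε.trans_le (min_le_left _ _)
  have hεβ : ε < β.re := hε.trans_le (min_le_right _ _)
  refine ⟨?_, ?_⟩
  · have hcont : ContinuousOn (fun u : ℝ => (1 - (u : ℂ) * Complex.exp μ) ^ (-β)) (Icc 0 1) :=
      fun u hu => ContinuousAt.continuousWithinAt (ContinuousAt.cpow (by fun_prop) continuousAt_const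
        (one_sub_mul_exp_mem_slitPlane hu.1 hμim0 hμim))
    have hbeta := integrableOn_beta hα hγα'
    rw [← integrableOn_Icc_iff_integrableOn_Ioo] at hbeta ⊢
    exact hbeta.mul_continuousOn hcont isCompact_Icc
  have him : (μ - π * I).im = μ.im - π := by simp
  have hw : |(μ - π * I).im| < π := by
    rw [him, abs_lt]
    constructor <;> linarith
  have hswap := integral_mul_integral_exp_log_swap (ν := volume.restrict (Ioo 0 1))
    (integrable_Gamma_mul_Gamma_mul_exp hε0 hεβ hw) (integrableOn_beta hεα hγα')
  have hleft : ∀ y : ℝ,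
      Complex.Gamma (ε - I * y) * Complex.exp ((-(ε : ℂ) + I * y) * (μ - π * I)) *
          Complex.Gamma (β - ε + I * y) *
        ∫ u : ℝ in Ioo 0 1, (u : ℂ) ^ (α - ε - 1) * (1 - (u : ℂ)) ^ (γ - α - 1) *
          Complex.exp (I * y * Real.log u) =
      Complex.Gamma (γ - α) * (Complex.exp ((-(ε : ℂ) + I * y) * (μ - π * I)) *
        Complex.Gamma (ε - I * y) * Complex.Gamma (α - ε + I * y) *
        Complex.Gamma (β - ε + I * y) / Complex.Gamma (γ - ε + I * y)) := by
    intro y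
    have hinner : ∫ u : ℝ in Ioo 0 1, (u : ℂ) ^ (α - ε - 1) * (1 - (u : ℂ)) ^ (γ - α - 1) *
          Complex.exp (I * y * Real.log u) =
        Complex.Gamma (α - ε + I * y) * Complex.Gamma (γ - α) /
          Complex.Gamma (γ - ε + I * y) := by
      rw [show γ - ε + I * y = α - ε + I * y + (γ - α) by ring,
        ← integral_beta (by simpa using hεα) hγα']
      refine setIntegral_congr_fun measurableSet_Ioo fun u hu => ?_
      have := cpow_mul_exp_log (y := y) (s := α - ε - 1) hu.1
      simp only [show α - ε + I * y - 1 = α - ε - 1 + I * y by ring, ← this]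
      ring
    rw [hinner]
    ring
  have hright : ∫ u : ℝ in Ioo 0 1, (u : ℂ) ^ (α - ε - 1) * (1 - (u : ℂ)) ^ (γ - α - 1) *
        ∫ y : ℝ, Complex.Gamma (ε - I * y) *
          Complex.exp ((-(ε : ℂ) + I * y) * (μ - π * I)) * Complex.Gamma (β - ε + I * y) *
          Complex.exp (I * y * Real.log u) =
      2 * π * Complex.Gamma β * ∫ u : ℝ in Ioo 0 1, (u : ℂ) ^ (α - 1) *
        (1 - (u : ℂ)) ^ (γ - α - 1) * (1 - (u : ℂ) * Complex.exp μ) ^ (-β) := by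
    rw [← integral_const_mul]
    refine setIntegral_congr_fun measurableSet_Ioo fun u hu => ?_
    have hC := integral_Gamma_mul_Gamma_mul_exp (w := μ - π * I + Real.log u) hε0 hεβ (by
      rwa [Complex.add_im, Complex.ofReal_im, add_zero])
    have hexp : 1 + Complex.exp (μ - π * I + Real.log u) = 1 - u * Complex.exp μ := by
      rw [Complex.exp_add, exp_ofReal_log hu.1, Complex.exp_sub, Complex.exp_pi_mul_I]
      ring
    rw [hexp] at hC
    have hinner : ∫ y : ℝ, Complex.Gamma (ε - I * y) *
          Complex.exp ((-(ε : ℂ) + I * y) * (μ - π * I)) * Complex.Gamma (β - ε + I * y) *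
          Complex.exp (I * y * Real.log u) =
        Complex.exp (ε * Real.log u) *
          (2 * π * (Complex.Gamma β * (1 - u * Complex.exp μ) ^ (-β))) := by
      rw [← hC, ← integral_const_mul]
      congr 1 with y
      linear_combination Complex.Gamma (ε - I * y) * Complex.Gamma (β - ε + I * y) *
        exp_mul_exp_log ε y (Real.log u) (μ - π * I)
    simp only [hinner, ← cpow_sub_mul_exp_log (ε := ε) (s := α) hu.1]
    ring
  simp only [hleft] at hswap
  rw [integral_const_mul, hright] at hswap
  have hΓ : Complex.Gamma (γ - α) ≠ 0 := Complex.Gamma_ne_zero_of_re_pos hγα'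
  have hpi : (π : ℂ) ≠ 0 := by simp [Real.pi_ne_zero]
  rw [BarnesB]
  field_simp
  linear_combination hswap
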